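/- Let X be a non-empty Polish space and let n be a positive integer. Then d^n_P(X × [0,1]ⁿ) = dim_P(X × [0,1]ⁿ) = dim_P X + n, where X × [0,1]ⁿ carries the ℓ² product metric. -/

import Mathlib

open Set Metric Filter Topology TopologicalSpace
open scoped ENNReal NNReal

noncomputable section

universe u

/-- `indBelow n X` means that the small inductive (topological) dimension of `X`
is at most `n - 1`; in particular `indBelow 0 X` means `X = ∅`. -/
def indBelow : ℕ → ∀ (X : Type u) [TopologicalSpace X], Prop
  | 0, X, _ => IsEmpty X
  | n + 1, X, inst =>
      letI := inst
      ∀ (x : X) (U : Set X), IsOpen U → x ∈ U →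
        ∃ V : Set X, IsOpen V ∧ x ∈ V ∧ V ⊆ U ∧ indBelow n ↥(frontier V)

/-- The small inductive (topological) dimension, with values in `EReal`:
`-1` for the empty space and `⊤` if there is no finite bound. -/
def indDim (X : Type u) [TopologicalSpace X] : EReal :=
  sInf {d : EReal | ∃ n : ℕ, indBelow n X ∧ d = (n : EReal) - 1}

variable {X : Type u} [MetricSpace X]

/-- Topological dimension of a subset of a metric space. -/
def tdim (A : Set X) : EReal := indDim ↥A

open Classical in
/-- Hausdorff dimension of a subset of a metric space,
with the convention `dim ∅ = -1`. -/
def hdim (A : Set X) : EReal := if A = ∅ then -1 else ((dimH A : ℝ≥0∞) : EReal)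

/-- A `δ`-packing of `A`: a countable family of pairwise disjoint closed balls
with centers in `A` and radii at most `δ`. -/
def IsPacking (A : Set X) (δ : ℝ≥0) (s : Set (X × ℝ≥0)) : Prop :=
  s.Countable ∧ (∀ p ∈ s, p.1 ∈ A ∧ p.2 ≤ δ) ∧
    s.Pairwise fun p q => Disjoint (closedBall p.1 (p.2 : ℝ)) (closedBall q.1 (q.2 : ℝ))

/-- The packing pre-measure `P^h_δ(A)`. -/
def packPre (h : ℝ≥0 → ℝ≥0) (A : Set X) (δ : ℝ≥0) : ℝ≥0∞ :=
  ⨆ (s : Set (X × ℝ≥0)) (_ : IsPacking A δ s), ∑' p : s, ((h p.1.2 : ℝ≥0) : ℝ≥0∞)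

/-- The packing pre-measure (packing number) `P^h₀(A) = lim_{δ → 0+} P^h_δ(A)`. -/
def packPre0 (h : ℝ≥0 → ℝ≥0) (A : Set X) : ℝ≥0∞ :=
  ⨅ (δ : ℝ≥0) (_ : 0 < δ), packPre h A δ

/-- The `h`-packing measure `𝒫^h(A)`. -/
def packMeasure (h : ℝ≥0 → ℝ≥0) (A : Set X) : ℝ≥0∞ :=
  ⨅ (c : ℕ → Set X) (_ : A = ⋃ i, c i), ∑' i, packPre0 h (c i)

open Classical in
/-- The packing dimension, with the convention `dim ∅ = -1`. -/
def pdim (A : Set X) : EReal :=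
  if A = ∅ then -1
  else max 0 (⨆ (s : ℝ≥0) (_ : packMeasure (fun r => r ^ (s : ℝ)) A = ∞), ((s : ℝ) : EReal))

/-- The restriction of the packing measure `𝒫^h` to `A` is σ-finite. -/
def PackSigmaFiniteOn (h : ℝ≥0 → ℝ≥0) (A : Set X) : Prop :=
  ∃ c : ℕ → Set X, A ⊆ ⋃ i, c i ∧ ∀ i, packMeasure h (A ∩ c i) < ∞

/-- The generalized Hausdorff measure `ℋ^h(A)` associated to a gauge function `h`. -/
def hMeasure (h : ℝ≥0 → ℝ≥0) (A : Set X) : ℝ≥0∞ :=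
  ⨆ (δ : ℝ≥0) (_ : 0 < δ),
    ⨅ (c : ℕ → Set X) (_ : A ⊆ ⋃ i, c i) (_ : ∀ i, EMetric.diam (c i) ≤ (δ : ℝ≥0∞)),
      ∑' i, ((h (EMetric.diam (c i)).toNNReal : ℝ≥0) : ℝ≥0∞)

/-- `F` is an `F_σ` subset of the subspace `A`. -/
def IsFSigmaIn (F A : Set X) : Prop :=
  ∃ C : ℕ → Set X, (∀ i, IsClosed (C i)) ∧ F = ⋃ i, C i ∩ A

/-- `d^n_*(A) = inf {dim_*(A ∖ F) : F ⊆ A is F_σ in A and dim_T F ≤ n - 1}`. -/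
def dStar (dim : Set X → EReal) (n : ℕ) (A : Set X) : EReal :=
  sInf {d : EReal |
    ∃ F : Set X, IsFSigmaIn F A ∧ tdim F ≤ (n : EReal) - 1 ∧ d = dim (A \ F)}

end

/-- Small inductive dimension is monotone under embeddings. -/
theorem indBelow_of_isEmbedding (n : ℕ) : ∀ {Y : Type*} {Z : Type*} [TopologicalSpace Y]
    [TopologicalSpace Z] {f : Y → Z}, IsEmbedding f → indBelow n Z → indBelow n Y := by
  induction n with
  | zero =>
    intro Y Z _ _ f _ hZ
    have : IsEmpty Z := hZ
    exact f.isEmpty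
  | succ n ih =>
    intro Y Z _ _ f hf hZ x U hU hxU
    obtain ⟨U', hU', rfl⟩ := hf.isOpen_iff.1 hU
    obtain ⟨V, hV, hxV, hVU, hfr⟩ := hZ (f x) U' hU' hxU
    have hsub : MapsTo f (frontier (f ⁻¹' V)) (frontier V) := fun y hy =>
      hf.continuous.frontier_preimage_subset V hy
    refine ⟨f ⁻¹' V, hV.preimage hf.continuous, hxV, preimage_mono hVU,
      ih (f := hsub.restrict) ?_ hfr⟩
    exact (hf.comp IsEmbedding.subtypeVal).codRestrict (frontier V) fun y => hsub y.2

theorem indBelow_succ_of_indBelow (n : ℕ) : ∀ {Y : Type*} [TopologicalSpace Y],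
    indBelow n Y → indBelow (n + 1) Y := by
  induction n with
  | zero =>
    intro Y _ hY x
    have : IsEmpty Y := hY
    exact isEmptyElim x
  | succ n ih =>
    intro Y _ hY x U hU hxU
    obtain ⟨V, hV, hxV, hVU, hfr⟩ := hY x U hU hxU
    exact ⟨V, hV, hxV, hVU, ih hfr⟩

theorem indBelow_mono {m n : ℕ} (h : m ≤ n) {Y : Type*} [TopologicalSpace Y]
    (hY : indBelow m Y) : indBelow n Y := by
  induction n, h using Nat.le_induction with
  | base => exact hY
  | succ n _ ih => exact indBelow_succ_of_indBelow n ih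

theorem indBelow_of_indDim_le {n : ℕ} {Y : Type*} [TopologicalSpace Y]
    (h : indDim Y ≤ (n : EReal) - 1) : indBelow n Y := by
  by_contra hn
  have hle : (n : EReal) ≤ indDim Y := by
    refine le_sInf ?_
    rintro d ⟨m, hm, rfl⟩
    have hlt : n + 1 ≤ m := by
      by_contra hmn
      exact hn (indBelow_mono (by omega) hm)
    have hR : (n : ℝ) ≤ (m : ℝ) - 1 := by
      have : ((n + 1 : ℕ) : ℝ) ≤ m := by exact_mod_cast hlt
      push_cast at this
      linarith
    have := EReal.coe_le_coe_iff.2 hR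
    rwa [EReal.coe_sub] at this
  have hR : (n : ℝ) ≤ (n : ℝ) - 1 := by
    rw [← EReal.coe_le_coe_iff, EReal.coe_sub]
    exact hle.trans h
  linarith

/-- Every open cover of `K` indexed by `ι` shrinks to an open cover of order at most `n` at the
points of `B`. -/
def ShrinksToOrder {K : Type*} [TopologicalSpace K] (ι : Type*) (n : ℕ) (B : Set K) : Prop :=
  ∀ U : ι → Set K, (∀ i, IsOpen (U i)) → ⋃ i, U i = univ →
    ∃ V : ι → Set K, (∀ i, IsOpen (V i)) ∧ (∀ i, V i ⊆ U i) ∧ ⋃ i, V i = univ ∧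
      ∀ x ∈ B, {i | x ∈ V i}.ncard ≤ n

theorem ShrinksToOrder.of_subtype {K ι : Type*} [TopologicalSpace K] {n : ℕ} {B : Set K}
    (hB : IsClosed B) (h : ShrinksToOrder ι n (univ : Set ↥B)) : ShrinksToOrder ι n B := by
  intro U hU hcov
  obtain ⟨V, hV, hVU, hVcov, hord⟩ := h (fun i => (↑) ⁻¹' U i)
    (fun i => (hU i).preimage continuous_subtype_val) (by rw [← preimage_iUnion, hcov, preimage_univ])
  choose O hO hOV using fun i => isOpen_induced_iff.1 (hV i)
  refine ⟨fun i => U i ∩ (O i ∪ Bᶜ), fun i => (hU i).inter ((hO i).union hB.isOpen_compl),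
    fun i => inter_subset_left, ?_, ?_⟩
  · refine eq_univ_of_forall fun x => ?_
    by_cases hx : x ∈ B
    · obtain ⟨i, hi⟩ := mem_iUnion.1 (hVcov ▸ mem_univ (⟨x, hx⟩ : B))
      refine mem_iUnion.2 ⟨i, hVU i hi, Or.inl ?_⟩
      rw [← hOV i] at hi
      exact hi
    · obtain ⟨i, hi⟩ := mem_iUnion.1 (hcov ▸ mem_univ x)
      exact mem_iUnion.2 ⟨i, hi, Or.inr hx⟩
  · intro x hx
    convert hord ⟨x, hx⟩ (mem_univ _) using 2
    ext i
    simp only [mem_ofPred_eq, ← hOV i]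
    constructor
    · rintro ⟨-, h | h⟩
      · exact h
      · exact absurd hx h
    · intro h
      have h' : (⟨x, hx⟩ : B) ∈ V i := by rw [← hOV i]; exact h
      exact ⟨hVU i h', Or.inl h⟩

theorem ShrinksToOrder.biUnion {K ι α : Type*} [TopologicalSpace K] [Finite ι] {n : ℕ}
    (T : Finset α) (B : α → Set K) (h : ∀ a ∈ T, ShrinksToOrder ι n (B a)) :
    ShrinksToOrder ι n (⋃ a ∈ T, B a) := by
  classical
  induction T using Finset.induction_on with
  | empty => exact fun U hU hcov => ⟨U, hU, fun _ => Subset.rfl, hcov, by simp⟩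
  | insert a T _ ih =>
    intro U hU hcov
    obtain ⟨V, hV, hVU, hVcov, hVord⟩ :=
      ih (fun b hb => h b (Finset.mem_insert_of_mem hb)) U hU hcov
    obtain ⟨W, hW, hWV, hWcov, hWord⟩ := h a (Finset.mem_insert_self a T) V hV hVcov
    refine ⟨W, hW, fun i => (hWV i).trans (hVU i), hWcov, fun x hx => ?_⟩
    rw [Finset.set_biUnion_insert] at hx
    rcases hx with hx | hx
    · exact hWord x hx
    · exact (ncard_le_ncard (fun i hi => hWV i hi) (toFinite _)).trans (hVord x hx)

/-- In a space covered by finitely many open sets `V a ⊆ U (c a)`, the order of a cover on the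
union of the frontiers of the sets `V a` grows by at most one when passing to the whole space. -/
theorem ShrinksToOrder.of_frontier {K ι : Type*} [TopologicalSpace K] [NormalSpace K]
    [Finite ι] {n : ℕ}
    (h : ∀ U : ι → Set K, (∀ i, IsOpen (U i)) → ⋃ i, U i = univ → ∃ (T : Finset K)
      (V : K → Set K) (c : K → ι), (∀ a, IsOpen (V a)) ∧ (∀ a, V a ⊆ U (c a)) ∧
        ⋃ a ∈ T, V a = univ ∧ ShrinksToOrder ι n (⋃ a ∈ T, frontier (V a))) :
    ShrinksToOrder ι (n + 1) (univ : Set K) := by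
  classical
  intro U hU hcov
  obtain ⟨T, V, c, hV, hVU, hVcov, hfr⟩ := h U hU hcov
  set B := ⋃ a ∈ T, frontier (V a) with hBdef
  have hBc : IsClosed B := T.finite_toSet.isClosed_biUnion fun a _ => isClosed_frontier
  obtain ⟨O, hO, hOU, hOcov, hOord⟩ := hfr U hU hcov
  obtain ⟨P, hPcov, hP, hPO⟩ := exists_iUnion_eq_closure_subset hO (fun x => toFinite _) hOcov
  let N : Set K := {x | {i | x ∈ closure (P i)}.ncard ≤ n}
  have hNopen : IsOpen N := by
    refine isOpen_iff_mem_nhds.2 fun x hx => ?_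
    have hev : ∀ᶠ z in 𝓝 x, ∀ i, z ∈ closure (P i) → x ∈ closure (P i) := by
      refine Filter.eventually_all.2 fun i => ?_
      by_cases hxi : x ∈ closure (P i)
      · exact Eventually.of_forall fun _ _ => hxi
      · filter_upwards [isClosed_closure.isOpen_compl.mem_nhds hxi] with z hz hz'
        exact absurd hz' hz
    filter_upwards [hev] with z hz
    exact (ncard_le_ncard (fun i hi => hz i hi) (toFinite _)).trans hx
  have hBN : B ⊆ N := fun x hx =>
    (ncard_le_ncard (fun i hi => hPO i hi) (toFinite _)).trans (hOord x hx)
  have hex : ∀ x : K, ∃ a, a ∈ T.filter fun a => x ∈ V a := fun x => by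
    obtain ⟨a, ha, hxa⟩ := mem_iUnion₂.1 (hVcov ▸ mem_univ x : x ∈ ⋃ a ∈ T, V a)
    exact ⟨a, Finset.mem_filter.2 ⟨ha, hxa⟩⟩
  let pick : Finset K → Option ι := fun S => if hS : S.Nonempty then some (c hS.choose) else none
  let pattern : K → Finset K := fun x => T.filter fun a => x ∈ V a
  have hpick : ∀ x i, pick (pattern x) = some i → x ∈ U i := by
    intro x i hi
    have hne : (pattern x).Nonempty := hex x
    simp only [pick, dif_pos hne, Option.some.injEq] at hi
    rw [← hi]
    exact hVU _ (Finset.mem_filter.1 hne.choose_spec).2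
  let W : ι → Set K := fun i => {x | x ∉ B ∧ pick (pattern x) = some i}
  have hWopen : ∀ i, IsOpen (W i) := by
    refine fun i => isOpen_iff_mem_nhds.2 fun x hx => ?_
    have hev : ∀ᶠ z in 𝓝 x, ∀ a ∈ T, (z ∈ V a ↔ x ∈ V a) := by
      refine (Filter.eventually_all_finset T).2 fun a ha => ?_
      by_cases hxa : x ∈ V a
      · filter_upwards [(hV a).mem_nhds hxa] with z hz
        exact iff_of_true hz hxa
      · have hcl : x ∉ closure (V a) := fun hcl => hx.1 <| mem_iUnion₂.2
          ⟨a, ha, hcl, fun hint => hxa (interior_subset hint)⟩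
        filter_upwards [isClosed_closure.isOpen_compl.mem_nhds hcl] with z hz
        exact iff_of_false (fun h => hz (subset_closure h)) hxa
    filter_upwards [hev, hBc.isOpen_compl.mem_nhds hx.1] with z hz hzB
    have hpat : pattern z = pattern x := Finset.filter_congr hz
    exact ⟨hzB, by rw [hpat]; exact hx.2⟩
  refine ⟨fun i => (P i ∩ N) ∪ W i, fun i => ((hP i).inter hNopen).union (hWopen i), ?_, ?_, ?_⟩
  · rintro i x (hx | hx)
    · exact hOU i (hPO i (subset_closure hx.1))
    · exact hpick x i hx.2
  · refine eq_univ_of_forall fun x => ?_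
    by_cases hx : x ∈ B
    · obtain ⟨i, hi⟩ := mem_iUnion.1 (hPcov ▸ mem_univ x)
      exact mem_iUnion.2 ⟨i, Or.inl ⟨hi, hBN hx⟩⟩
    · have hne : (pattern x).Nonempty := hex x
      exact mem_iUnion.2 ⟨c hne.choose, Or.inr ⟨hx, by simp only [pick, dif_pos hne]⟩⟩
  · intro x _
    have hsub : {i | x ∈ (P i ∩ N) ∪ W i} ⊆ {i | x ∈ P i ∩ N} ∪ {i | x ∈ W i} := fun i hi => hi
    have h₁ : {i | x ∈ P i ∩ N}.ncard ≤ n := by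
      by_cases hxN : x ∈ N
      · exact (ncard_le_ncard (show {i | x ∈ P i ∩ N} ⊆ {i | x ∈ closure (P i)} from
          fun i hi => subset_closure hi.1) (toFinite _)).trans hxN
      · simp [hxN]
    have h₂ : {i | x ∈ W i}.ncard ≤ 1 := by
      rw [ncard_le_one]
      intro i hi j hj
      exact Option.some.inj (hi.2.symm.trans hj.2)
    calc _ ≤ _ := ncard_le_ncard hsub (toFinite _)
      _ ≤ _ := ncard_union_le _ _
      _ ≤ n + 1 := add_le_add h₁ h₂

/-- The covering dimension of a compact Hausdorff space is at most its inductive dimension. -/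
theorem shrinksToOrder_of_indBelow (ι : Type*) [Finite ι] (n : ℕ) :
    ∀ (K : Type*) [TopologicalSpace K] [CompactSpace K] [T2Space K],
      indBelow n K → ShrinksToOrder ι n (univ : Set K) := by
  induction n with
  | zero =>
    intro K _ _ _ hK U hU hcov
    have : IsEmpty K := hK
    exact ⟨U, hU, fun _ => Subset.rfl, hcov, fun x => isEmptyElim x⟩
  | succ n ih =>
    intro K _ _ _ hK
    refine ShrinksToOrder.of_frontier fun U hU hcov => ?_
    choose c hc using fun x : K => mem_iUnion.1 (hcov ▸ mem_univ x)
    choose V hV hxV hVU hfr using fun x : K => hK x (U (c x)) (hU _) (hc x)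
    obtain ⟨T, hT⟩ := isCompact_univ.elim_finite_subcover V hV
      fun x _ => mem_iUnion.2 ⟨x, hxV x⟩
    refine ⟨T, V, c, hV, hVU, univ_subset_iff.1 hT, ShrinksToOrder.biUnion T _ fun a _ => ?_⟩
    have : CompactSpace ↥(frontier (V a)) := isCompact_iff_compactSpace.1
      isClosed_frontier.isCompact
    exact ShrinksToOrder.of_subtype isClosed_frontier (ih _ (hfr a))

/-- If `g` has `i`-th component zero on the two faces orthogonal to the `i`-th axis, then a small
multiple of `g` perturbs the identity to a map of the unit cube onto itself. -/
theorem image_add_smul_Icc {n : ℕ} {g : (Fin n → ℝ) → Fin n → ℝ} {L : ℝ≥0}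
    (hg : LipschitzOnWith L g (Icc 0 1)) (h0 : ∀ x ∈ Icc (0 : Fin n → ℝ) 1, ∀ i, x i = 0 → g x i = 0)
    (h1 : ∀ x ∈ Icc (0 : Fin n → ℝ) 1, ∀ i, x i = 1 → g x i = 0) {t : ℝ≥0} (ht : t * L < 1) :
    InjOn (fun x => x + (t : ℝ) • g x) (Icc 0 1) ∧
      (fun x => x + (t : ℝ) • g x) '' Icc 0 1 = Icc 0 1 := by
  have htL : (t : ℝ) * L < 1 := by exact_mod_cast ht
  refine ⟨fun x hx y hy hxy => ?_, Subset.antisymm ?_ fun y hy => ?_⟩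
  · have hxy' : x - y = (t : ℝ) • (g y - g x) := by
      rw [smul_sub, sub_eq_sub_iff_add_eq_add]
      simpa [add_comm] using hxy
    have h2 : dist x y ≤ t * (L * dist x y) := by
      calc dist x y = t * dist (g y) (g x) := by
            rw [dist_eq_norm, hxy', norm_smul, Real.norm_of_nonneg t.coe_nonneg, dist_eq_norm]
        _ ≤ t * (L * dist x y) := by
            rw [dist_comm x y]
            gcongr
            exact hg.dist_le_mul y hy x hx
    by_contra hne
    nlinarith [dist_pos.2 hne]
  · rintro _ ⟨x, hx, rfl⟩
    have key : ∀ a ∈ Icc (0 : ℝ) 1, ∀ i, (Function.update x i a) ∈ Icc (0 : Fin n → ℝ) 1 := by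
      intro a ha i
      constructor <;> intro j <;> rcases eq_or_ne j i with rfl | hj
      · simpa using ha.1
      · simpa [hj] using hx.1 j
      · simpa using ha.2
      · simpa [hj] using hx.2 j
    have bound : ∀ a ∈ Icc (0 : ℝ) 1, ∀ i, g (Function.update x i a) i = 0 →
        (t : ℝ) * |g x i| ≤ |x i - a| := by
      intro a ha i hi
      have h3 := hg.dist_le_mul x hx _ (key a ha i)
      have h4 : |g x i| ≤ L * |x i - a| := by
        calc |g x i| = dist (g x i) (g (Function.update x i a) i) := by rw [hi, Real.dist_eq, sub_zero]
          _ ≤ _ := dist_le_pi_dist _ _ i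
          _ ≤ _ := h3
          _ ≤ L * |x i - a| := by
            gcongr
            refine (dist_pi_le_iff (abs_nonneg _)).2 fun j => ?_
            rcases eq_or_ne j i with rfl | hj
            · simp [Real.dist_eq]
            · simp [hj]
      calc (t : ℝ) * |g x i| ≤ t * (L * |x i - a|) := by gcongr
        _ ≤ |x i - a| := by nlinarith [abs_nonneg (x i - a)]
    constructor <;> intro i
    · have := bound 0 (by simp) i (h0 _ (key 0 (by simp) i) i (by simp))
      have hxi : 0 ≤ x i := hx.1 i
      rw [sub_zero, abs_of_nonneg hxi] at this
      have := neg_abs_le (g x i)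
      simp only [Pi.zero_apply, Pi.add_apply, Pi.smul_apply, smul_eq_mul]
      nlinarith [t.2]
    · have := bound 1 (by simp) i (h1 _ (key 1 (by simp) i) i (by simp))
      have hxi : x i ≤ 1 := hx.2 i
      rw [abs_of_nonpos (sub_nonpos.2 hxi)] at this
      have := le_abs_self (g x i)
      simp only [Pi.one_apply, Pi.add_apply, Pi.smul_apply, smul_eq_mul]
      nlinarith [t.2]
  · let clamp : (Fin n → ℝ) → Fin n → ℝ := fun x i => projIcc (0 : ℝ) 1 zero_le_one (x i)
    have hclamp : LipschitzWith 1 clamp := LipschitzWith.of_dist_le_mul fun x y => by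
      refine (dist_pi_le_iff (by positivity)).2 fun i => ?_
      have := (LipschitzWith.projIcc (zero_le_one (α := ℝ))).dist_le_mul (x i) (y i)
      exact this.trans (by gcongr; exact dist_le_pi_dist _ _ i)
    have hmem : ∀ x, clamp x ∈ Icc (0 : Fin n → ℝ) 1 := fun x =>
      ⟨fun i => (projIcc (0 : ℝ) 1 zero_le_one (x i)).2.1,
        fun i => (projIcc (0 : ℝ) 1 zero_le_one (x i)).2.2⟩
    have hcontr : ContractingWith (t * L) fun x => y - (t : ℝ) • g (clamp x) := by
      refine ⟨ht, LipschitzWith.of_dist_le_mul fun x z => ?_⟩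
      rw [dist_sub_left, dist_smul₀, Real.norm_of_nonneg t.coe_nonneg, NNReal.coe_mul, mul_assoc]
      have h5 := hg.dist_le_mul _ (hmem x) _ (hmem z)
      have h6 := hclamp.dist_le_mul x z
      simp only [NNReal.coe_one, one_mul] at h6
      gcongr
      exact h5.trans (by gcongr)
    set x := ContractingWith.fixedPoint _ hcontr with hxdef
    have hx : y - (t : ℝ) • g (clamp x) = x := hcontr.fixedPoint_isFixedPt
    have hxi : ∀ i, x i = y i - t * g (clamp x) i := fun i => (congrFun hx i).symm
    have hxI : x ∈ Icc (0 : Fin n → ℝ) 1 := by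
      constructor <;> intro i
      · by_contra hneg
        have hneg' : x i < 0 := not_le.1 hneg
        have : clamp x i = 0 := by
          simp only [clamp, projIcc_of_le_left _ hneg'.le]
        have h7 := hxi i
        rw [h0 _ (hmem x) i this] at h7
        have : 0 ≤ y i := hy.1 i
        linarith
      · by_contra hneg
        have hneg' : 1 < x i := not_le.1 hneg
        have : clamp x i = 1 := by
          simp only [clamp, projIcc_of_right_le _ hneg'.le]
        have h7 := hxi i
        rw [h1 _ (hmem x) i this] at h7
        have : y i ≤ 1 := hy.2 i
        linarith
    have hcx : clamp x = x := by
      funext i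
      simp only [clamp]
      rw [projIcc_of_mem zero_le_one (show x i ∈ Icc (0 : ℝ) 1 from ⟨hxI.1 i, hxI.2 i⟩)]
    refine ⟨x, hxI, ?_⟩
    rw [hcx] at hx
    simp only
    exact (sub_eq_iff_eq_add.1 hx).symm

/-- Extrapolation at `1` of real polynomials of degree at most `n` from their values at `n + 1`
nodes. -/
theorem exists_extrapolation (n : ℕ) {v : Fin (n + 1) → ℝ} (hv : Function.Injective v) :
    ∃ c : Fin (n + 1) → ℝ, ∀ p : Polynomial ℝ, p.natDegree ≤ n →
      p.eval 1 = ∑ k, c k * p.eval (v k) := by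
  refine ⟨fun k => (Lagrange.basis Finset.univ v k).eval 1, fun p hp => ?_⟩
  have hdeg : p.degree < (Finset.univ : Finset (Fin (n + 1))).card := by
    rw [Finset.card_univ, Fintype.card_fin]
    exact Polynomial.degree_le_natDegree.trans_lt (by exact_mod_cast Nat.lt_succ_of_le hp)
  conv_lhs => rw [Lagrange.eq_interpolate hv.injOn hdeg, Lagrange.interpolate_apply]
  simp [Polynomial.eval_finsetSum, mul_comm]

/-- The determinant of `1 + t • A` is a polynomial in `t` of degree at most `n`. -/
theorem exists_polynomial_eval_eq_det {n : ℕ} (A : (Fin n → ℝ) →L[ℝ] (Fin n → ℝ)) :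
    ∃ p : Polynomial ℝ, p.natDegree ≤ n ∧
      ∀ t : ℝ, p.eval t = (ContinuousLinearMap.id ℝ (Fin n → ℝ) + t • A).det := by
  let M := LinearMap.toMatrix' (A : (Fin n → ℝ) →ₗ[ℝ] (Fin n → ℝ))
  refine ⟨(Polynomial.X • M.map ⇑Polynomial.C + (1 : Matrix (Fin n) (Fin n) ℝ).map ⇑Polynomial.C).det,
    (Polynomial.natDegree_det_X_add_C_le _ _).trans (by simp), fun t => ?_⟩
  rw [ContinuousLinearMap.det, ← LinearMap.det_toMatrix', ← Polynomial.coe_evalRingHom, RingHom.map_det]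
  congr 1
  ext i j
  simp [M, LinearMap.toMatrix'_apply, Matrix.one_apply, add_comm, Pi.single_apply]
  split_ifs <;> simp [mul_comm t]

open MeasureTheory in

/-- A continuously differentiable map with `f x i = 0` on `{x i = 0}` and `f x i = 1` on
`{x i = 1}` has a nondegenerate derivative at some point of the unit cube. -/
theorem exists_det_fderiv_ne_zero {n : ℕ} {f : (Fin n → ℝ) → Fin n → ℝ} (hf : ContDiff ℝ 1 f)
    (h0 : ∀ x ∈ Icc (0 : Fin n → ℝ) 1, ∀ i, x i = 0 → f x i = 0)
    (h1 : ∀ x ∈ Icc (0 : Fin n → ℝ) 1, ∀ i, x i = 1 → f x i = 1) :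
    ∃ x ∈ Icc (0 : Fin n → ℝ) 1, (fderiv ℝ f x).det ≠ 0 := by
  by_contra! hdet
  let E := Fin n → ℝ
  let Q : Set E := Icc 0 1
  have hQ : IsCompact Q := isCompact_Icc
  let g : E → E := fun x => f x - x
  have hg : ContDiff ℝ 1 g := hf.sub contDiff_id
  obtain ⟨L, hL⟩ := hg.contDiffOn.exists_lipschitzOnWith one_ne_zero (convex_Icc (0 : E) 1) hQ
  let A : E → E →L[ℝ] E := fderiv ℝ g
  have hA : Continuous A := hg.continuous_fderiv one_ne_zero
  have hfA : ∀ x, fderiv ℝ f x = ContinuousLinearMap.id ℝ E + A x := by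
    intro x
    simp only [A, g]
    rw [fderiv_fun_sub (hf.differentiable one_ne_zero x) differentiableAt_fun_id, fderiv_fun_id]
    abel
  let D : ℝ → E → ℝ := fun t x => (ContinuousLinearMap.id ℝ E + t • A x).det
  have hD : Continuous fun z : ℝ × E => D z.1 z.2 :=
    ContinuousLinearMap.continuous_det.comp
      (continuous_const.add (continuous_fst.smul (hA.comp continuous_snd)))
  have hpos : ∀ᶠ t in 𝓝 (0 : ℝ), ∀ x ∈ Q, 0 < D t x := by
    refine hQ.eventually_forall_of_forall_eventually fun x _ => ?_
    refine hD.continuousAt.eventually (lt_mem_nhds ?_)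
    simp [D, ContinuousLinearMap.det]
  have hlip : ∀ᶠ t in 𝓝 (0 : ℝ) , t * (L : ℝ) < 1 := by
    have hc : Continuous fun t : ℝ => t * L := continuous_id.mul continuous_const
    exact hc.continuousAt.eventually (gt_mem_nhds (by simp))
  obtain ⟨ε, hε, hball⟩ := Metric.eventually_nhds_iff.1 (hpos.and hlip)
  have hint : ∀ t : ℝ, 0 ≤ t → t < ε → ∫ x in Q, D t x = 1 := by
    intro t ht0 htε
    obtain ⟨hDpos, hLt⟩ := hball (y := t) (by simpa [abs_of_nonneg ht0] using htε)
    lift t to ℝ≥0 using ht0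
    obtain ⟨hinj, himage⟩ := image_add_smul_Icc hL
      (fun x hx i hi => by
        show f x i - x i = 0
        rw [h0 x hx i hi, hi, sub_zero])
      (fun x hx i hi => by
        show f x i - x i = 0
        rw [h1 x hx i hi, hi, sub_self]) (t := t) (by exact_mod_cast hLt)
    have hderiv : ∀ x ∈ Q, HasFDerivWithinAt (fun x => x + (t : ℝ) • g x)
        (ContinuousLinearMap.id ℝ E + (t : ℝ) • A x) Q x := fun x _ =>
      ((hasFDerivAt_id x).add
        ((hg.differentiable one_ne_zero x).hasFDerivAt.const_smul (t : ℝ))).hasFDerivWithinAt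
    have hvol := lintegral_abs_det_fderiv_eq_addHaar_image volume measurableSet_Icc hderiv hinj
    rw [himage, Real.volume_Icc_pi] at hvol
    have hcongr : ∫ x in Q, D t x = ∫ x in Q, |D t x| :=
      setIntegral_congr_fun measurableSet_Icc fun x hx => (abs_of_pos (hDpos x hx)).symm
    have hcont : Continuous fun x => |D t x| := (hD.comp (Continuous.prodMk_right (t : ℝ))).abs
    rw [hcongr, integral_eq_lintegral_of_nonneg_ae (Eventually.of_forall fun x => abs_nonneg _)
      hcont.aestronglyMeasurable]
    calc _ = (∏ i : Fin n, ENNReal.ofReal ((1 : E) i - (0 : E) i)).toReal :=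
          congrArg ENNReal.toReal hvol
      _ = 1 := by simp [E]
  let v : Fin (n + 1) → ℝ := fun k => ε * ((k : ℕ) / (n + 1 : ℝ))
  have hv : Function.Injective v := by
    intro j k hjk
    have hn : (n + 1 : ℝ) ≠ 0 := by positivity
    simp only [v] at hjk
    have h2 := mul_left_cancel₀ hε.ne' hjk
    rw [div_left_inj' hn] at h2
    exact Fin.ext (by exact_mod_cast h2)
  have hvε : ∀ k, 0 ≤ v k ∧ v k < ε := by
    intro k
    have hk : ((k : ℕ) : ℝ) < n + 1 := by exact_mod_cast k.2
    refine ⟨by positivity, ?_⟩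
    have : ((k : ℕ) : ℝ) / (n + 1 : ℝ) < 1 := (div_lt_one (by positivity)).2 hk
    simp only [v]
    nlinarith
  obtain ⟨c, hc⟩ := exists_extrapolation n hv
  have hsum : ∑ k, c k = 1 := by simpa using (hc 1 (by simp)).symm
  have hDsum : ∀ x ∈ Q, ∑ k, c k * D (v k) x = 0 := by
    intro x hx
    obtain ⟨p, hp, hpe⟩ := exists_polynomial_eval_eq_det (A x)
    have h3 := hc p hp
    simp only [hpe, one_smul] at h3
    rw [← hfA, hdet x hx] at h3
    exact h3.symm
  have hzero : ∫ x in Q, ∑ k, c k * D (v k) x = 0 := by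
    rw [setIntegral_congr_fun measurableSet_Icc hDsum]
    simp
  rw [integral_finsetSum] at hzero
  · simp only [integral_const_mul] at hzero
    rw [Finset.sum_congr rfl fun k _ => by rw [hint _ (hvε k).1 (hvε k).2, mul_one]] at hzero
    rw [hsum] at hzero
    exact one_ne_zero hzero
  · intro k _
    exact ((hD.comp (Continuous.prodMk_right (v k))).continuousOn.integrableOn_compact hQ).const_mul _

/-- A finite sum of point masses moving in general directions has degenerate derivative wherever
at most `n` of the coefficients, which form a partition of unity, are not locally zero. -/
theorem det_fderiv_sum_smul_eq_zero {n : ℕ} {ι : Type*} [Fintype ι] {ρ : ι → (Fin n → ℝ) → ℝ}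
    (e : ι → Fin n → ℝ) (hρ : ∀ w, Differentiable ℝ (ρ w)) (hsum : ∀ x, ∑ w, ρ w x = 1)
    {x : Fin n → ℝ} (hord : {w | x ∈ tsupport (ρ w)}.ncard ≤ n) :
    (fderiv ℝ (fun x => ∑ w, ρ w x • e w) x).det = 0 := by
  classical
  let J : Finset ι := Finset.univ.filter fun w => x ∈ tsupport (ρ w)
  have hJ : J.card ≤ n := by
    rw [← Set.ncard_coe_finset]
    simpa [J] using hord
  obtain ⟨w₀, hw₀⟩ : ∃ w, ρ w x ≠ 0 := by
    by_contra! h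
    simpa [h] using hsum x
  have hw₀J : w₀ ∈ J := Finset.mem_filter.2 ⟨Finset.mem_univ _, subset_tsupport _ hw₀⟩
  let Φ : (Fin n → ℝ) →ₗ[ℝ] (↥(J.erase w₀) → ℝ) :=
    LinearMap.pi fun w => (fderiv ℝ (ρ w) x : (Fin n → ℝ) →ₗ[ℝ] ℝ)
  have hker : LinearMap.ker Φ ≠ ⊥ := by
    refine LinearMap.ker_ne_bot_of_finrank_lt ?_
    rw [Module.finrank_fintype_fun_eq_card, Module.finrank_fintype_fun_eq_card, Fintype.card_coe,
      Fintype.card_fin]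
    exact (Finset.card_erase_lt_of_mem hw₀J).trans_le hJ
  obtain ⟨v, hv, hv0⟩ := Submodule.exists_mem_ne_zero_of_ne_bot hker
  have hne : ∀ w, w ≠ w₀ → fderiv ℝ (ρ w) x v = 0 := by
    intro w hw
    by_cases hwJ : w ∈ J
    · exact congrFun hv ⟨w, Finset.mem_erase.2 ⟨hw, hwJ⟩⟩
    · have : x ∉ tsupport (ρ w) := by simpa [J] using hwJ
      rw [fderiv_of_notMem_tsupport ℝ this, zero_apply]
  have hsum' : ∑ w, fderiv ℝ (ρ w) x v = 0 := by
    have h := fderiv_fun_sum (𝕜 := ℝ) (u := Finset.univ) (x := x) fun w _ => hρ w x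
    simp only [hsum] at h
    have h' := congrArg (fun T : (Fin n → ℝ) →L[ℝ] ℝ => T v) h
    simpa using h'.symm
  have hall : ∀ w, fderiv ℝ (ρ w) x v = 0 := by
    intro w
    rcases eq_or_ne w w₀ with rfl | hw
    · rwa [Finset.sum_eq_single_of_mem w (Finset.mem_univ _) fun b _ hb => hne b hb] at hsum'
    · exact hne w hw
  have hderiv : fderiv ℝ (fun x => ∑ w, ρ w x • e w) x v = 0 := by
    rw [fderiv_fun_sum fun w _ => (hρ w x).smul_const (e w)]
    simp [fderiv_smul_const (hρ _ x), hall]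
  exact LinearMap.det_eq_zero_iff_ker_ne_bot.2 fun hbot =>
    hv0 (LinearMap.ker_eq_bot'.1 hbot v hderiv)

open scoped Manifold ContDiff in

/-- The inductive dimension of the `n`-cube is at least `n`. -/
theorem not_indBelow_Icc (n : ℕ) : ¬ indBelow n ↥(Icc (0 : Fin n → ℝ) 1) := by
  intro hind
  have : CompactSpace ↥(Icc (0 : Fin n → ℝ) 1) := isCompact_iff_compactSpace.1 isCompact_Icc
  let clamp : (Fin n → ℝ) → ↥(Icc (0 : Fin n → ℝ) 1) := fun x =>
    ⟨fun i => projIcc (0 : ℝ) 1 zero_le_one (x i),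
      fun i => (projIcc (0 : ℝ) 1 zero_le_one (x i)).2.1,
      fun i => (projIcc (0 : ℝ) 1 zero_le_one (x i)).2.2⟩
  have hclamp : Continuous clamp := by
    refine Continuous.subtype_mk (continuous_pi fun i => ?_) _
    exact continuous_subtype_val.comp (continuous_projIcc.comp (continuous_apply i))
  let U : (Fin n → Bool) → Set ↥(Icc (0 : Fin n → ℝ) 1) := fun w =>
    ⋂ i, {x | if w i then 0 < x.1 i else x.1 i < 1}
  have hU : ∀ w, IsOpen (U w) := by
    intro w
    refine isOpen_iInter_of_finite fun i => ?_
    have hc : Continuous fun x : ↥(Icc (0 : Fin n → ℝ) 1) => x.1 i :=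
      (continuous_apply i).comp continuous_subtype_val
    cases w i
    · simpa using isOpen_lt hc continuous_const
    · simpa using isOpen_lt continuous_const hc
  have hUcov : ⋃ w, U w = univ := by
    refine eq_univ_of_forall fun x => mem_iUnion.2 ⟨fun i => decide (0 < x.1 i), ?_⟩
    refine mem_iInter.2 fun i => ?_
    by_cases hi : 0 < x.1 i
    · simp [hi]
    · simp only [mem_ofPred_eq, hi, decide_false, Bool.false_eq_true, if_false]
      linarith
  obtain ⟨V, hV, hVU, hVcov, hord⟩ :=
    shrinksToOrder_of_indBelow (Fin n → Bool) n _ hind U hU hUcov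
  obtain ⟨ρ, hρ⟩ := SmoothPartitionOfUnity.exists_isSubordinate 𝓘(ℝ, Fin n → ℝ)
    (isClosed_univ (X := Fin n → ℝ)) (fun w => clamp ⁻¹' V w) (fun w => (hV w).preimage hclamp)
    (by rw [← preimage_iUnion, hVcov, preimage_univ])
  have hρU : ∀ w x, ρ w x ≠ 0 → clamp x ∈ U w := fun w x hx =>
    hVU w (hρ w (subset_tsupport _ hx))
  have hsum : ∀ x, ∑ w, ρ w x = 1 := fun x => by
    rw [← finsum_eq_sum_of_fintype]
    exact ρ.sum_eq_one (mem_univ x)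
  have hsmooth : ∀ w, ContDiff ℝ ∞ (ρ w) := fun w => (ρ w).contMDiff.contDiff
  let e : (Fin n → Bool) → Fin n → ℝ := fun w i => if w i then 1 else 0
  have h0 : ∀ x ∈ Icc (0 : Fin n → ℝ) 1, ∀ i, x i = 0 → (∑ w, ρ w x • e w) i = 0 := by
    intro x _ i hxi
    rw [Finset.sum_apply]
    refine Finset.sum_eq_zero fun w _ => ?_
    by_cases hw : w i
    · have : ρ w x = 0 := by
        by_contra hne
        have := mem_iInter.1 (hρU w x hne) i
        simp [hw, clamp, hxi] at this
      simp [this]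
    · simp [e, hw]
  have h1 : ∀ x ∈ Icc (0 : Fin n → ℝ) 1, ∀ i, x i = 1 → (∑ w, ρ w x • e w) i = 1 := by
    intro x _ i hxi
    rw [Finset.sum_apply, ← hsum x]
    refine Finset.sum_congr rfl fun w _ => ?_
    by_cases hw : w i
    · simp [e, hw]
    · have : ρ w x = 0 := by
        by_contra hne
        have := mem_iInter.1 (hρU w x hne) i
        simp [hw, clamp, hxi] at this
      simp [this]
  obtain ⟨x, -, hx⟩ := exists_det_fderiv_ne_zero (f := fun x => ∑ w, ρ w x • e w)
    (ContDiff.sum fun w _ => ((hsmooth w).of_le (by simp)).smul contDiff_const) h0 h1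
  refine hx (det_fderiv_sum_smul_eq_zero e
    (fun w => (hsmooth w).differentiable (by simp)) hsum ?_)
  exact (ncard_le_ncard (fun w hw => hρ w hw) (toFinite _)).trans (hord (clamp x) (mem_univ _))

/-- The upper Minkowski content of `A` of dimension `s` is finite: `r`-separated subsets of `A` have
at most `C * r ^ (-s)` elements for small `r`. -/
def HasBoxBound {M : Type*} [MetricSpace M] (s : ℝ) (A : Set M) : Prop :=
  ∃ C δ : ℝ, 0 < δ ∧ ∀ r, 0 < r → r ≤ δ → ∀ S : Finset M, (S : Set M) ⊆ A →
    (S : Set M).Pairwise (fun x y => r < dist x y) → (S.card : ℝ) * r ^ s ≤ C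

/-- `A` is covered by countably many sets with finite upper Minkowski content. -/
def SigmaBoxBound {M : Type*} [MetricSpace M] (s : ℝ) (A : Set M) : Prop :=
  ∃ c : ℕ → Set M, A ⊆ ⋃ i, c i ∧ ∀ i, HasBoxBound s (c i)

section BoxBound

variable {M : Type*} [MetricSpace M] {s : ℝ} {A B : Set M}

theorem HasBoxBound.mono (h : HasBoxBound s B) (hAB : A ⊆ B) : HasBoxBound s A := by
  obtain ⟨C, δ, hδ, hC⟩ := h
  exact ⟨C, δ, hδ, fun r hr hrδ S hS => hC r hr hrδ S (hS.trans hAB)⟩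

theorem hasBoxBound_empty : HasBoxBound s (∅ : Set M) :=
  ⟨0, 1, one_pos, fun r _ _ S hS _ => by
    have : S = ∅ := by simpa using hS
    simp [this]⟩

theorem HasBoxBound.closure (h : HasBoxBound s A) : HasBoxBound s (closure A) := by
  classical
  obtain ⟨C, δ, hδ, hC⟩ := h
  refine ⟨C / (1 / 2) ^ s, δ, hδ, fun r hr hrδ S hS hsep => ?_⟩
  have hex : ∀ x : M, ∃ a, x ∈ S → a ∈ A ∧ dist x a < r / 4 := by
    intro x
    by_cases hx : x ∈ S
    · obtain ⟨a, ha, hxa⟩ := Metric.mem_closure_iff.1 (hS hx) (r / 4) (by positivity)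
      exact ⟨a, fun _ => ⟨ha, hxa⟩⟩
    · exact ⟨x, fun h => absurd h hx⟩
  choose f hf using hex
  have hfsep : ∀ x ∈ S, ∀ y ∈ S, x ≠ y → r / 2 < dist (f x) (f y) := by
    intro x hx y hy hxy
    have h1 := hsep hx hy hxy
    have h2 := (hf x hx).2
    have h3 := (hf y hy).2
    have h4 := dist_triangle4 x (f x) (f y) y
    rw [dist_comm (f y) y] at h4
    linarith
  have hinj : InjOn f S := by
    intro x hx y hy hxy
    by_contra hne
    have := hfsep x hx y hy hne
    rw [hxy, dist_self] at this
    linarith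
  have := hC (r / 2) (by positivity) (by linarith) (S.image f)
    (by
      intro y hy
      obtain ⟨x, hx, rfl⟩ := Finset.mem_image.1 hy
      exact (hf x hx).1)
    (by
      intro y hy y' hy' hne
      obtain ⟨x, hx, rfl⟩ := Finset.mem_image.1 hy
      obtain ⟨x', hx', rfl⟩ := Finset.mem_image.1 hy'
      exact hfsep x hx x' hx' fun h => hne (h ▸ rfl))
  rw [Finset.card_image_of_injOn hinj, div_eq_mul_one_div r, Real.mul_rpow hr.le (by norm_num),
    ← mul_assoc] at this
  rwa [le_div_iff₀ (by positivity)]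

theorem SigmaBoxBound.mono (h : SigmaBoxBound s B) (hAB : A ⊆ B) : SigmaBoxBound s A := by
  obtain ⟨c, hc, hb⟩ := h
  exact ⟨c, hAB.trans hc, hb⟩

theorem HasBoxBound.sigmaBoxBound (h : HasBoxBound s A) : SigmaBoxBound s A :=
  ⟨fun _ => A, subset_iUnion (fun _ : ℕ => A) 0, fun _ => h⟩

theorem SigmaBoxBound.iUnion {ι : Type*} [Countable ι] {c : ι → Set M}
    (h : ∀ i, SigmaBoxBound s (c i)) : SigmaBoxBound s (⋃ i, c i) := by
  choose d hd hb using h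
  rcases isEmpty_or_nonempty ι with hι | hι
  · exact ⟨fun _ => ∅, by simp, fun _ => hasBoxBound_empty⟩
  · obtain ⟨f, hf⟩ := exists_surjective_nat (ι × ℕ)
    refine ⟨fun k => d (f k).1 (f k).2, iUnion_subset fun i x hx => ?_, fun k => hb _ _⟩
    obtain ⟨j, hj⟩ := mem_iUnion.1 (hd i hx)
    obtain ⟨k, hk⟩ := hf (i, j)
    exact mem_iUnion.2 ⟨k, by rw [hk]; exact hj⟩

theorem SigmaBoxBound.union (hA : SigmaBoxBound s A) (hB : SigmaBoxBound s B) :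
    SigmaBoxBound s (A ∪ B) := by
  rw [union_eq_iUnion]
  exact .iUnion fun b => by cases b <;> assumption

theorem HasBoxBound.nonneg (h : HasBoxBound s A) (hA : A.Nonempty) : 0 ≤ s := by
  obtain ⟨C, δ, hδ, hC⟩ := h
  obtain ⟨a, ha⟩ := hA
  by_contra! hs
  have h1 : ∀ᶠ r : ℝ in 𝓝[>] 0, r ≤ δ := by
    filter_upwards [Ioc_mem_nhdsGT hδ] with r hr using hr.2
  have h2 : ∀ᶠ r : ℝ in 𝓝[>] 0, C < r ^ s :=
    (tendsto_rpow_neg_nhdsGT_zero hs).eventually (eventually_gt_atTop C)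
  obtain ⟨r, hr1, hr2, hr⟩ := (h1.and (h2.and self_mem_nhdsWithin)).exists
  have := hC r hr hr1 {a} (by simpa using ha) (by simp)
  simp only [Finset.card_singleton, Nat.cast_one, one_mul] at this
  linarith

theorem hasBoxBound_of_packPre0_ne_top {s : ℝ≥0}
    (h : packPre0 (fun r => r ^ (s : ℝ)) A ≠ ∞) : HasBoxBound s A := by
  classical
  obtain ⟨δ, hlt⟩ := iInf_lt_iff.1 (lt_top_iff_ne_top.2 h)
  obtain ⟨hδ, hlt⟩ := iInf_lt_iff.1 hlt
  refine ⟨(packPre (fun r => r ^ (s : ℝ)) A δ).toReal / (1 / 2) ^ (s : ℝ), δ, hδ,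
    fun r hr hrδ S hS hsep => ?_⟩
  lift r to ℝ≥0 using hr.le
  let P : Finset (M × ℝ≥0) := S.image fun x => (x, r / 2)
  have hP : IsPacking A δ (P : Set (M × ℝ≥0)) := by
    refine ⟨P.countable_toSet, ?_, ?_⟩
    · intro p hp
      obtain ⟨x, hx, rfl⟩ := Finset.mem_image.1 hp
      exact ⟨hS hx, (half_le_self zero_le).trans (by exact_mod_cast hrδ)⟩
    · intro p hp q hq hpq
      obtain ⟨x, hx, rfl⟩ := Finset.mem_image.1 hp
      obtain ⟨y, hy, rfl⟩ := Finset.mem_image.1 hq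
      have hxy := hsep hx hy fun hxy => hpq (by rw [hxy])
      refine closedBall_disjoint_closedBall ?_
      push_cast
      linarith
  have hle : ((S.card : ℝ≥0) * (r / 2) ^ (s : ℝ) : ℝ≥0) ≤ packPre (fun r => r ^ (s : ℝ)) A δ := by
    refine le_trans (le_of_eq ?_) (le_iSup₂ (f := fun (t : Set (M × ℝ≥0)) (_ : IsPacking A δ t) =>
      ∑' p : t, (((p.1.2) ^ (s : ℝ) : ℝ≥0) : ℝ≥0∞)) (P : Set (M × ℝ≥0)) hP)
    rw [Finset.tsum_subtype' P fun p : M × ℝ≥0 => ((p.2 ^ (s : ℝ) : ℝ≥0) : ℝ≥0∞),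
      Finset.sum_image (by simp)]
    simp only [Finset.sum_const, nsmul_eq_mul]
    push_cast
    rfl
  have hreal := ENNReal.toReal_mono hlt.ne hle
  rw [le_div_iff₀ (by positivity), mul_assoc, ← Real.mul_rpow hr.le (by norm_num),
    ← div_eq_mul_one_div]
  simpa using hreal

theorem packPre0_eq_zero (h : HasBoxBound s A) {t : ℝ≥0} (hs : 0 ≤ s) (hst : s < t) :
    packPre0 (fun r => r ^ (t : ℝ)) A = 0 := by
  classical
  obtain ⟨C, δ, hδ, hC⟩ := h
  have ht : 0 < (t : ℝ) := hs.trans_lt hst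
  have hC0 : 0 ≤ C := by simpa using hC δ hδ le_rfl ∅ (by simp) (by simp)
  set y : ℝ := 1 / 2 with hy
  have hy0 : 0 < y := by norm_num [hy]
  have hy1 : y < 1 := by norm_num [hy]
  set a := y ^ s with ha
  set b := y ^ (t : ℝ) with hb
  have ha0 : 0 < a := Real.rpow_pos_of_pos hy0 _
  have hb0 : 0 < b := Real.rpow_pos_of_pos hy0 _
  set q := b / a with hq
  have hq0 : 0 < q := by positivity
  have hq1 : q < 1 := (div_lt_one ha0).2 (Real.rpow_lt_rpow_of_exponent_gt hy0 hy1 hst)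
  have hcomm : ∀ (k : ℕ) (u : ℝ), (y ^ k) ^ u = (y ^ u) ^ k := fun k u => by
    rw [← Real.rpow_natCast, ← Real.rpow_natCast, ← Real.rpow_mul hy0.le, ← Real.rpow_mul hy0.le,
      mul_comm]
  have hbound : ∀ k₀ : ℕ, y ^ k₀ ≤ δ → packPre (fun r => r ^ (t : ℝ)) A (y ^ k₀).toNNReal ≤
      ENNReal.ofReal (C / a * (q ^ k₀ / (1 - q))) := by
    intro k₀ hk₀
    refine iSup₂_le fun P hP => ?_
    rw [ENNReal.tsum_eq_iSup_sum]
    refine iSup_le fun Φ => ?_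
    have hrad : ∀ p : P, (p.1.2 : ℝ) ≤ y ^ k₀ := fun p => by
      have := NNReal.coe_le_coe.2 (hP.2.1 p.1 p.2).2
      rwa [Real.coe_toNNReal _ (by positivity)] at this
    have hlev : ∀ p : P, ∃ k : ℕ, 0 < (p.1.2 : ℝ) → y ^ (k + 1) < p.1.2 ∧ (p.1.2 : ℝ) ≤ y ^ k := by
      intro p
      by_cases hp : 0 < (p.1.2 : ℝ)
      · obtain ⟨k, hk⟩ := exists_nat_pow_near_of_lt_one hp
          ((hrad p).trans (pow_le_one₀ hy0.le hy1.le)) hy0 hy1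
        exact ⟨k, fun _ => hk⟩
      · exact ⟨0, fun h => absurd h hp⟩
    choose lev hlev using hlev
    let Ψ := Φ.filter fun p => 0 < (p.1.2 : ℝ)
    have hΨ : ∑ p ∈ Φ, ((p.1.2 ^ (t : ℝ) : ℝ≥0) : ℝ≥0∞) =
        ENNReal.ofReal (∑ p ∈ Ψ, (p.1.2 : ℝ) ^ (t : ℝ)) := by
      rw [ENNReal.ofReal_sum_of_nonneg fun p _ => by positivity]
      rw [Finset.sum_filter]
      refine Finset.sum_congr rfl fun p _ => ?_
      split_ifs with hp
      · rw [← NNReal.coe_rpow, ENNReal.ofReal_coe_nnreal]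
      · have : p.1.2 = 0 := le_antisymm (by exact_mod_cast not_lt.1 hp) zero_le
        simp [this, NNReal.zero_rpow ht.ne']
    rw [hΨ]
    refine ENNReal.ofReal_le_ofReal ?_
    have hge : ∀ p ∈ Ψ, k₀ ≤ lev p := by
      intro p hp
      have h1 := (hlev p (Finset.mem_filter.1 hp).2).1.trans_le (hrad p)
      have := (pow_lt_pow_iff_right_of_lt_one₀ hy0 hy1).1 h1
      omega
    have hfib : ∀ k, k₀ ≤ k → ∑ p ∈ Ψ.filter (fun p => lev p = k), (p.1.2 : ℝ) ^ (t : ℝ) ≤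
        C / a * q ^ k := by
      intro k hk
      set Θ := Ψ.filter fun p => lev p = k with hΘ
      have hΘmem : ∀ p ∈ Θ, y ^ (k + 1) < p.1.2 ∧ (p.1.2 : ℝ) ≤ y ^ k := by
        intro p hp
        obtain ⟨hp1, rfl⟩ := Finset.mem_filter.1 hp
        exact hlev p (Finset.mem_filter.1 hp1).2
      have hsep : ∀ p ∈ Θ, ∀ p' ∈ Θ, p ≠ p' → y ^ (k + 1) < dist p.1.1 p'.1.1 := by
        intro p hp p' hp' hne
        have hdisj := hP.2.2 p.2 p'.2 fun h => hne (Subtype.ext h)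
        by_contra! hle
        refine disjoint_left.1 hdisj (mem_closedBall_self p.1.2.2) ?_
        exact mem_closedBall.2 (hle.trans (hΘmem p' hp').1.le)
      have hinj : InjOn (fun p : P => p.1.1) Θ := by
        intro p hp p' hp' hpp
        by_contra hne
        have := hsep p hp p' hp' hne
        simp only at hpp
        rw [hpp, dist_self] at this
        exact absurd this (not_lt.2 (by positivity))
      have hcard := hC (y ^ (k + 1)) (by positivity)
        ((pow_le_pow_of_le_one hy0.le hy1.le (by omega)).trans hk₀) (Θ.image fun p => p.1.1)
        (by
          intro x hx
          obtain ⟨p, _, rfl⟩ := Finset.mem_image.1 hx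
          exact (hP.2.1 p.1 p.2).1)
        (by
          intro x hx x' hx' hne
          obtain ⟨p, hp, rfl⟩ := Finset.mem_image.1 hx
          obtain ⟨p', hp', rfl⟩ := Finset.mem_image.1 hx'
          exact hsep p hp p' hp' fun h => hne (h ▸ rfl))
      rw [Finset.card_image_of_injOn hinj, hcomm, ← ha] at hcard
      calc ∑ p ∈ Θ, (p.1.2 : ℝ) ^ (t : ℝ) ≤ ∑ p ∈ Θ, b ^ k := by
            refine Finset.sum_le_sum fun p hp => ?_
            rw [hb, ← hcomm]
            exact Real.rpow_le_rpow p.1.2.coe_nonneg (hΘmem p hp).2 ht.le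
        _ = (Θ.card * a ^ (k + 1)) * (q ^ k / a) := by
            rw [Finset.sum_const, nsmul_eq_mul, hq, div_pow]
            field_simp
            ring
        _ ≤ C * (q ^ k / a) := by gcongr
        _ = C / a * q ^ k := by ring
    let I := Ψ.image lev
    have hI : I ⊆ Finset.Ico k₀ (I.sup id + 1) := by
      intro k hk
      obtain ⟨p, hp, rfl⟩ := Finset.mem_image.1 hk
      exact Finset.mem_Ico.2 ⟨hge p hp, Nat.lt_succ_of_le (Finset.le_sup (f := id) hk)⟩
    calc ∑ p ∈ Ψ, (p.1.2 : ℝ) ^ (t : ℝ)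
        = ∑ k ∈ I, ∑ p ∈ Ψ.filter (fun p => lev p = k), (p.1.2 : ℝ) ^ (t : ℝ) :=
          (Finset.sum_fiberwise_of_maps_to (fun p hp => Finset.mem_image_of_mem _ hp) _).symm
      _ ≤ ∑ k ∈ I, C / a * q ^ k :=
          Finset.sum_le_sum fun k hk => hfib k (Finset.mem_Ico.1 (hI hk)).1
      _ ≤ ∑ k ∈ Finset.Ico k₀ (I.sup id + 1), C / a * q ^ k :=
          Finset.sum_le_sum_of_subset_of_nonneg hI fun _ _ _ => by positivity
      _ ≤ C / a * (q ^ k₀ / (1 - q)) := by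
          rw [← Finset.mul_sum]
          gcongr
          exact geom_sum_Ico_le_of_lt_one hq0.le hq1
  have hlim : Tendsto (fun k : ℕ => ENNReal.ofReal (C / a * (q ^ k / (1 - q)))) atTop (𝓝 0) := by
    rw [← ENNReal.ofReal_zero]
    refine (ENNReal.continuous_ofReal.tendsto 0).comp ?_
    have := ((tendsto_pow_atTop_nhds_zero_of_lt_one hq0.le hq1).div_const (1 - q)).const_mul (C / a)
    simpa using this
  have hsmall : ∀ᶠ k : ℕ in atTop, y ^ k ≤ δ :=
    (tendsto_pow_atTop_nhds_zero_of_lt_one hy0.le hy1).eventually (Iic_mem_nhds hδ)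
  refine le_antisymm (ge_of_tendsto hlim ?_) zero_le
  filter_upwards [hsmall] with k hk
  exact (iInf₂_le (y ^ k).toNNReal (Real.toNNReal_pos.2 (by positivity))).trans (hbound k hk)

theorem sigmaBoxBound_of_pdim_lt (h : pdim A < (s : EReal)) : SigmaBoxBound s A := by
  rcases A.eq_empty_or_nonempty with rfl | hA
  · exact hasBoxBound_empty.sigmaBoxBound
  rw [pdim, if_neg hA.ne_empty, max_lt_iff] at h
  have hs : 0 < s := by exact_mod_cast h.1
  lift s to ℝ≥0 using hs.le
  have hfin : packMeasure (fun r => r ^ (s : ℝ)) A ≠ ∞ := fun htop =>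
    (le_iSup₂_of_le (f := fun (s : ℝ≥0) (_ : packMeasure (fun r => r ^ (s : ℝ)) A = ∞) =>
      ((s : ℝ) : EReal)) s htop le_rfl).not_gt h.2
  obtain ⟨c, hlt⟩ := iInf_lt_iff.1 (lt_top_iff_ne_top.2 hfin)
  obtain ⟨hc, hlt⟩ := iInf_lt_iff.1 hlt
  exact ⟨c, hc.subset, fun i => hasBoxBound_of_packPre0_ne_top
    ((ENNReal.le_tsum i).trans_lt hlt).ne⟩

theorem pdim_le_of_sigmaBoxBound (h : SigmaBoxBound s A) (hA : A.Nonempty) :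
    pdim A ≤ (s : EReal) := by
  obtain ⟨c, hc, hb⟩ := h
  have hs : 0 ≤ s := by
    obtain ⟨a, ha⟩ := hA
    obtain ⟨i, hi⟩ := mem_iUnion.1 (hc ha)
    exact (hb i).nonneg ⟨a, hi⟩
  rw [pdim, if_neg hA.ne_empty]
  refine max_le (by exact_mod_cast hs) (iSup₂_le fun t ht => ?_)
  by_contra! hst
  have hst' : s < t := by exact_mod_cast hst
  have hzero : packMeasure (fun r => r ^ (t : ℝ)) A ≤ 0 := by
    refine (iInf₂_le (fun i => c i ∩ A) ?_).trans ?_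
    · rw [← iUnion_inter, inter_eq_right.2 hc]
    · rw [nonpos_iff_eq_zero, ENNReal.tsum_eq_zero]
      exact fun i => packPre0_eq_zero ((hb i).mono inter_subset_left) hs hst'
  rw [ht] at hzero
  exact absurd hzero (by simp)

theorem Finset.exists_maximal_separated (S : Finset M) {r : ℝ} (hr : 0 < r) :
    ∃ T ⊆ S, (T : Set M).Pairwise (fun x y => r < dist x y) ∧ ∀ x ∈ S, ∃ y ∈ T, dist x y ≤ r := by
  classical
  induction S using Finset.induction_on with
  | empty => exact ⟨∅, Finset.Subset.refl _, by simp, by simp⟩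
  | insert a S _ ih =>
    obtain ⟨T, hTS, hsep, hcov⟩ := ih
    by_cases ha : ∃ y ∈ T, dist a y ≤ r
    · refine ⟨T, hTS.trans (Finset.subset_insert a S), hsep, fun x hx => ?_⟩
      rcases Finset.mem_insert.1 hx with rfl | hx
      · exact ha
      · exact hcov x hx
    · push Not at ha
      refine ⟨insert a T, Finset.insert_subset_insert a hTS, ?_, fun x hx => ?_⟩
      · rw [Finset.coe_insert]
        refine hsep.insert fun y hy _ => ⟨ha y hy, ?_⟩
        rw [dist_comm]
        exact ha y hy
      · rcases Finset.mem_insert.1 hx with rfl | hx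
        · exact ⟨x, Finset.mem_insert_self x T, by simpa using hr.le⟩
        · obtain ⟨y, hy, hxy⟩ := hcov x hx
          exact ⟨y, Finset.mem_insert_of_mem hy, hxy⟩

end BoxBound

namespace WithLp

variable {X Y : Type*} [MetricSpace X] [MetricSpace Y]

theorem dist_eq_sqrt_prod (z w : WithLp 2 (X × Y)) :
    dist z w = √(dist z.fst w.fst ^ 2 + dist z.snd w.snd ^ 2) := by
  rw [WithLp.prod_dist_eq_add (by norm_num), Real.sqrt_eq_rpow]
  norm_num

theorem dist_fst_le_dist (z w : WithLp 2 (X × Y)) : dist z.fst w.fst ≤ dist z w := by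
  rw [dist_eq_sqrt_prod]
  exact Real.le_sqrt_of_sq_le (by linarith [sq_nonneg (dist z.snd w.snd)])

theorem dist_snd_le_dist (z w : WithLp 2 (X × Y)) : dist z.snd w.snd ≤ dist z w := by
  rw [dist_eq_sqrt_prod]
  exact Real.le_sqrt_of_sq_le (by linarith [sq_nonneg (dist z.fst w.fst)])

theorem dist_le_dist_fst_add_dist_snd (z w : WithLp 2 (X × Y)) :
    dist z w ≤ dist z.fst w.fst + dist z.snd w.snd := by
  rw [dist_eq_sqrt_prod, Real.sqrt_le_iff]
  have h1 : 0 ≤ dist z.fst w.fst := dist_nonneg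
  have h2 : 0 ≤ dist z.snd w.snd := dist_nonneg
  exact ⟨by positivity, by nlinarith [mul_nonneg h1 h2]⟩

end WithLp

/-- The unit cube `[0, 1]ⁿ` with the Euclidean metric. -/
abbrev UnitCube (n : ℕ) := {x : EuclideanSpace ℝ (Fin n) // ∀ i, x i ∈ Set.Icc (0:ℝ) 1}

namespace UnitCube

variable {n : ℕ}

theorem abs_sub_le_dist (u v : UnitCube n) (i : Fin n) : |u.1 i - v.1 i| ≤ dist u v := by
  rw [Subtype.dist_eq, EuclideanSpace.dist_eq, ← Real.dist_eq]
  refine Real.le_sqrt_of_sq_le ?_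
  exact Finset.single_le_sum (f := fun i => dist (u.1 i) (v.1 i) ^ 2)
    (fun _ _ => sq_nonneg _) (Finset.mem_univ i)

theorem dist_le_of_forall_abs_sub_le {u v : UnitCube n} {a : ℝ} (ha : 0 ≤ a)
    (h : ∀ i, |u.1 i - v.1 i| ≤ a) : dist u v ≤ n * a := by
  rw [Subtype.dist_eq, EuclideanSpace.dist_eq, Real.sqrt_le_iff]
  refine ⟨by positivity, ?_⟩
  have h1 : ∑ i, dist (u.1 i) (v.1 i) ^ 2 ≤ ∑ _i : Fin n, a ^ 2 :=
    Finset.sum_le_sum fun i _ => by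
      rw [Real.dist_eq]
      exact pow_le_pow_left₀ (abs_nonneg _) (h i) 2
  have h2 : (n : ℝ) ≤ (n : ℝ) ^ 2 := by exact_mod_cast Nat.le_self_pow two_ne_zero n
  rw [Finset.sum_const, Finset.card_univ, Fintype.card_fin, nsmul_eq_mul] at h1
  rw [mul_pow]
  exact h1.trans (mul_le_mul_of_nonneg_right h2 (sq_nonneg a))

instance : CompleteSpace (UnitCube n) := by
  have : IsClosed {x : EuclideanSpace ℝ (Fin n) | ∀ i, x i ∈ Set.Icc (0:ℝ) 1} := by
    simp only [ofPred_forall]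
    exact isClosed_iInter fun i => isClosed_Icc.preimage (by fun_prop)
  exact this.completeSpace_coe

/-- The point of the unit cube with given coordinates. -/
def ofCoord (u : Icc (0 : Fin n → ℝ) 1) : UnitCube n :=
  ⟨WithLp.toLp 2 u.1, fun i => ⟨u.2.1 i, u.2.2 i⟩⟩

theorem continuous_ofCoord : Continuous (ofCoord (n := n)) := by
  unfold ofCoord
  fun_prop

theorem injective_ofCoord : Function.Injective (ofCoord (n := n)) := fun _ _ h =>
  Subtype.ext (WithLp.toLp_injective 2 (congrArg Subtype.val h))

/-- Every ball in the unit cube contains a similar copy of the whole cube. -/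
theorem exists_similarity (y : UnitCube n) {ε : ℝ} (hε : 0 < ε) :
    ∃ η : ℝ, 0 < η ∧ η ≤ 1 ∧ ∃ j : UnitCube n → UnitCube n,
      (∀ u v, dist (j u) (j v) = η * dist u v) ∧ ∀ u, dist (j u) y < ε := by
  set η : ℝ := min 1 (ε / (n + 1)) with hη
  have hη0 : 0 < η := lt_min one_pos (by positivity)
  have hη1 : η ≤ 1 := min_le_left _ _
  have hηε : η * (n + 1) ≤ ε := (le_div_iff₀ (by positivity)).1 (min_le_right _ _)
  refine ⟨η, hη0, hη1, fun u => ⟨(1 - η) • y.1 + η • u.1, fun i => ?_⟩, fun u v => ?_, fun u => ?_⟩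
  · simp only [PiLp.add_apply, PiLp.smul_apply]
    exact (convex_Icc (0:ℝ) 1) (y.2 i) (u.2 i) (by linarith) hη0.le (by ring)
  · rw [Subtype.dist_eq, dist_add_left, dist_smul₀, Real.norm_of_nonneg hη0.le, Subtype.dist_eq]
  · refine (dist_le_of_forall_abs_sub_le hη0.le fun i => ?_).trans_lt
      (by nlinarith : (n : ℝ) * η < ε)
    have h1 := y.2 i
    have h2 := u.2 i
    simp only [PiLp.add_apply, PiLp.smul_apply, smul_eq_mul]
    rw [show (1 - η) * y.1 i + η * u.1 i - y.1 i = η * (u.1 i - y.1 i) by ring, abs_mul,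
      abs_of_pos hη0]
    have : |u.1 i - y.1 i| ≤ 1 :=
      abs_sub_le_iff.2 ⟨by linarith [h1.1, h2.2], by linarith [h1.2, h2.1]⟩
    nlinarith

end UnitCube

section Product

variable {X : Type*} [MetricSpace X] {n : ℕ} {s : ℝ}

theorem HasBoxBound.prod_unitCube {A : Set X} (h : HasBoxBound s A) :
    HasBoxBound (s + n) {z : WithLp 2 (X × UnitCube n) | z.fst ∈ A} := by
  classical
  obtain ⟨C, δ, hδ, hC⟩ := h
  refine ⟨C / (1 / 4) ^ s * (2 * n + 3) ^ n, min δ 1, lt_min hδ one_pos,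
    fun r hr hrδ S hS hsep => ?_⟩
  have hr1 : r ≤ 1 := hrδ.trans (min_le_right _ _)
  obtain ⟨T, hTS, hTsep, hT⟩ := Finset.exists_maximal_separated (S.image fun z => z.fst)
    (by positivity : 0 < r / 4)
  have hcard := hC (r / 4) (by positivity) (by linarith [hrδ.trans (min_le_left δ 1)]) T
    (by
      intro x hx
      obtain ⟨z, hz, rfl⟩ := Finset.mem_image.1 (hTS hx)
      exact hS hz) hTsep
  have hτ : ∀ z : WithLp 2 (X × UnitCube n), ∃ x, z ∈ S → x ∈ T ∧ dist z.fst x ≤ r / 4 := by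
    intro z
    by_cases hz : z ∈ S
    · obtain ⟨x, hx⟩ := hT _ (Finset.mem_image_of_mem _ hz)
      exact ⟨x, fun _ => hx⟩
    · exact ⟨z.fst, fun h => absurd h hz⟩
  choose τ hτ using hτ
  set m : ℕ := ⌈2 * n / r⌉₊ + 1 with hm
  have hm0 : (0 : ℝ) < m := by positivity
  have hmr : 2 * n ≤ r * m := by
    have := Nat.le_ceil (2 * n / r)
    rw [div_le_iff₀ hr] at this
    rw [hm]
    push_cast
    nlinarith
  have hmr' : (m + 1 : ℝ) * r ≤ 2 * n + 3 := by
    have := (Nat.ceil_lt_add_one (by positivity : 0 ≤ 2 * n / r)).le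
    have h2 : 2 * n / r * r = 2 * n := div_mul_cancel₀ _ hr.ne'
    rw [hm]
    push_cast
    nlinarith
  have hle : S.card ≤ (T ×ˢ Fintype.piFinset fun _ : Fin n => Finset.range (m + 1)).card := by
    refine Finset.card_le_card_of_injOn (fun z => (τ z, fun i => ⌊z.snd.1 i * m⌋₊)) ?_ ?_
    · intro z hz
      refine Finset.mem_coe.2 (Finset.mem_product.2 ⟨(hτ z hz).1, Fintype.mem_piFinset.2 fun i => ?_⟩)
      refine Finset.mem_range.2 (Nat.lt_succ_of_le (Nat.floor_le_of_le ?_))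
      exact mul_le_of_le_one_left hm0.le (z.snd.2 i).2
    · intro z hz w hw hzw
      by_contra hne
      obtain ⟨h1, h2⟩ := Prod.ext_iff.1 hzw
      have hfst : dist z.fst w.fst ≤ r / 2 := by
        have h3 := (hτ z hz).2
        have h4 := (hτ w hw).2
        simp only at h1
        rw [← h1] at h4
        linarith [dist_triangle_right z.fst w.fst (τ z)]
      have hsnd : dist z.snd w.snd ≤ r / 2 := by
        refine (UnitCube.dist_le_of_forall_abs_sub_le (a := 1 / m) (by positivity)
          fun i => ?_).trans ?_
        · have h3 := congrFun h2 i
          simp only at h3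
          have ha : 0 ≤ z.snd.1 i * m := mul_nonneg (z.snd.2 i).1 hm0.le
          have hb : 0 ≤ w.snd.1 i * m := mul_nonneg (w.snd.2 i).1 hm0.le
          have : |z.snd.1 i * m - w.snd.1 i * m| < 1 := by
            refine Int.abs_sub_lt_one_of_floor_eq_floor ?_
            rw [← Int.natCast_floor_eq_floor ha, ← Int.natCast_floor_eq_floor hb, h3]
          rw [← sub_mul, abs_mul, abs_of_pos hm0] at this
          exact (le_div_iff₀ hm0).2 this.le
        · rw [mul_one_div, div_le_div_iff₀ hm0 two_pos]
          linarith
      have := hsep hz hw hne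
      linarith [WithLp.dist_le_dist_fst_add_dist_snd z w]
  rw [Finset.card_product, Fintype.card_piFinset_const, Finset.card_range] at hle
  have hle' : (S.card : ℝ) ≤ T.card * (m + 1) ^ n := by exact_mod_cast hle
  rw [Real.rpow_add hr, Real.rpow_natCast]
  rw [div_eq_mul_one_div r, Real.mul_rpow hr.le (by norm_num), ← mul_assoc,
    ← le_div_iff₀ (by positivity)] at hcard
  calc (S.card : ℝ) * (r ^ s * r ^ n) ≤ T.card * (m + 1) ^ n * (r ^ s * r ^ n) := by gcongr
    _ = T.card * r ^ s * ((m + 1) * r) ^ n := by rw [mul_pow]; ring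
    _ ≤ C / (1 / 4) ^ s * (2 * n + 3) ^ n := by
        gcongr
        exact le_trans (by positivity) hcard

theorem HasBoxBound.of_prod_unitCube {D : Set (WithLp 2 (X × UnitCube n))}
    (h : HasBoxBound (s + n) D) {U : Set X} {y : UnitCube n} {ε : ℝ} (hε : 0 < ε)
    (hD : ∀ z : WithLp 2 (X × UnitCube n), z.fst ∈ U → dist z.snd y < ε → z ∈ D) :
    HasBoxBound s U := by
  classical
  obtain ⟨C, δ, hδ, hC⟩ := h
  obtain ⟨η, hη0, hη1, j, hj, hjy⟩ := UnitCube.exists_similarity y hε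
  refine ⟨C / η ^ (s + n), min δ (1 / 2), lt_min hδ (by norm_num), fun r hr hrδ S hS hsep => ?_⟩
  have hrδ' : r ≤ δ := hrδ.trans (min_le_left _ _)
  have hr2 : r ≤ 1 / 2 := hrδ.trans (min_le_right _ _)
  obtain ⟨m, hm⟩ : ∃ m, ⌈1 / r⌉₊ = m + 1 :=
    Nat.exists_eq_succ_of_ne_zero (Nat.ceil_pos.2 (by positivity)).ne'
  have hmr : 1 ≤ r * (m + 1) := by
    have := Nat.le_ceil (1 / r)
    rw [hm, div_le_iff₀ hr] at this
    push_cast at this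
    linarith
  have hmr' : m * r < 1 := by
    have := Nat.ceil_lt_add_one (by positivity : 0 ≤ 1 / r)
    rw [hm] at this
    push_cast at this
    exact (lt_div_iff₀ hr).1 (by linarith)
  have hm0 : (0 : ℝ) < m := by
    by_contra! hm'
    nlinarith
  let g : (Fin n → Fin (m + 1)) → UnitCube n := fun k =>
    UnitCube.ofCoord ⟨fun i => (k i : ℝ) / m, fun i => by positivity, fun i => by
      have : ((k i : ℕ) : ℝ) ≤ m := by exact_mod_cast Nat.le_of_lt_succ (k i).2
      exact (div_le_one hm0).2 this⟩
  have hg : ∀ k k', k ≠ k' → r < dist (g k) (g k') := by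
    intro k k' hne
    obtain ⟨i, hi⟩ := Function.ne_iff.1 hne
    refine lt_of_lt_of_le ?_ (UnitCube.abs_sub_le_dist _ _ i)
    change r < |(k i : ℝ) / m - (k' i : ℝ) / m|
    rw [← sub_div, abs_div, abs_of_pos hm0, lt_div_iff₀ hm0]
    refine lt_of_lt_of_le (by linarith : r * m < 1) ?_
    have hi' : ((k i : ℕ) : ℤ) - (k' i : ℕ) ≠ 0 := fun h => hi (Fin.ext (by omega))
    exact_mod_cast Int.one_le_abs hi'
  let φ : X × (Fin n → Fin (m + 1)) → WithLp 2 (X × UnitCube n) :=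
    fun p => WithLp.toLp 2 (p.1, j (g p.2))
  have hφ : ∀ p ∈ S ×ˢ (Finset.univ : Finset (Fin n → Fin (m + 1))),
      ∀ q ∈ S ×ˢ (Finset.univ : Finset (Fin n → Fin (m + 1))), p ≠ q →
        η * r < dist (φ p) (φ q) := by
    intro p hp q hq hne
    by_cases h1 : p.1 = q.1
    · have h2 : p.2 ≠ q.2 := fun h2 => hne (Prod.ext h1 h2)
      refine lt_of_lt_of_le ?_ (WithLp.dist_snd_le_dist _ _)
      change η * r < dist (j (g p.2)) (j (g q.2))
      rw [hj]
      exact mul_lt_mul_of_pos_left (hg _ _ h2) hη0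
    · have := hsep (Finset.mem_product.1 hp).1 (Finset.mem_product.1 hq).1 h1
      refine lt_of_lt_of_le ?_ (WithLp.dist_fst_le_dist _ _)
      change η * r < dist p.1 q.1
      nlinarith
  have hinj : InjOn φ (S ×ˢ (Finset.univ : Finset (Fin n → Fin (m + 1))) : Finset _) := by
    intro p hp q hq hpq
    by_contra hne
    have := hφ p hp q hq hne
    rw [hpq, dist_self] at this
    exact absurd this (not_lt.2 (by positivity))
  have hcard := hC (η * r) (by positivity) (by nlinarith)
    ((S ×ˢ (Finset.univ : Finset (Fin n → Fin (m + 1)))).image φ)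
    (by
      intro z hz
      obtain ⟨p, hp, rfl⟩ := Finset.mem_image.1 hz
      exact hD _ (hS (Finset.mem_product.1 hp).1) (hjy _))
    (by
      intro z hz z' hz' hne
      obtain ⟨p, hp, rfl⟩ := Finset.mem_image.1 hz
      obtain ⟨p', hp', rfl⟩ := Finset.mem_image.1 hz'
      exact hφ p hp p' hp' fun h => hne (h ▸ rfl))
  rw [Finset.card_image_of_injOn hinj, Finset.card_product, Finset.card_univ, Fintype.card_fun,
    Fintype.card_fin, Fintype.card_fin, Real.mul_rpow hη0.le hr.le] at hcard
  push_cast at hcard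
  rw [le_div_iff₀ (by positivity)]
  refine le_trans ?_ hcard
  rw [Real.rpow_add hr, Real.rpow_natCast]
  calc (S.card : ℝ) * r ^ s * η ^ (s + n) = S.card * r ^ s * η ^ (s + n) * 1 := by ring
    _ ≤ S.card * r ^ s * η ^ (s + n) * (r * (m + 1)) ^ n := by
        gcongr
        exact one_le_pow₀ hmr
    _ = _ := by rw [mul_pow]; ring

end Product

section Main

variable {X : Type*} [MetricSpace X] {n : ℕ}

theorem EReal.le_of_forall_real_lt {a b : EReal} (h : ∀ t : ℝ, b < t → a ≤ t) : a ≤ b := by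
  refine le_of_forall_gt_imp_ge_of_dense fun c hc => ?_
  obtain ⟨t, hbt, htc⟩ := EReal.lt_iff_exists_real_btwn.1 hc
  exact (h t hbt).trans htc.le

theorem EReal.coe_sub_natCast_lt {t : ℝ} {a : EReal} (h : (t : EReal) < a + (n : EReal)) :
    ((t - n : ℝ) : EReal) < a := by
  by_contra! hle
  refine h.not_ge ((add_le_add_left hle (n : EReal)).trans ?_)
  rw [← EReal.coe_natCast, ← EReal.coe_add, _root_.sub_add_cancel]

theorem EReal.lt_coe_sub_natCast {t : ℝ} {a : EReal} (h : a + (n : EReal) < (t : EReal)) :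
    a < ((t - n : ℝ) : EReal) := by
  by_contra! hle
  refine h.not_ge (le_trans ?_ (add_le_add_left hle (n : EReal)))
  rw [← EReal.coe_natCast, ← EReal.coe_add, _root_.sub_add_cancel]

instance : Nonempty (UnitCube n) := ⟨UnitCube.ofCoord ⟨0, le_rfl, zero_le_one⟩⟩

theorem pdim_prod_unitCube_le [Nonempty X] :
    pdim (univ : Set (WithLp 2 (X × UnitCube n))) ≤ pdim (univ : Set X) + (n : EReal) := by
  refine EReal.le_of_forall_real_lt fun t ht => ?_
  obtain ⟨c, hc, hb⟩ := sigmaBoxBound_of_pdim_lt (EReal.lt_coe_sub_natCast ht)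
  refine pdim_le_of_sigmaBoxBound ⟨fun i => {z | z.fst ∈ c i}, fun z _ => ?_, fun i => ?_⟩
    ⟨WithLp.toLp 2 (Classical.arbitrary _), mem_univ _⟩
  · obtain ⟨i, hi⟩ := mem_iUnion.1 (hc (mem_univ z.fst))
    exact mem_iUnion.2 ⟨i, hi⟩
  · have := (hb i).prod_unitCube (n := n)
    rwa [sub_add_cancel] at this

/-- If `X` is not `SigmaBoxBound s`, then it contains a non-empty closed set, no non-empty relatively
open subset of which is `SigmaBoxBound s`. -/
theorem exists_isClosed_not_sigmaBoxBound [SecondCountableTopology X] {s : ℝ}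
    (h : ¬ SigmaBoxBound s (univ : Set X)) :
    ∃ Y : Set X, IsClosed Y ∧ Y.Nonempty ∧
      ∀ O : Set X, IsOpen O → (O ∩ Y).Nonempty → ¬ SigmaBoxBound s (O ∩ Y) := by
  set 𝒱 : Set (Set X) := {V | IsOpen V ∧ SigmaBoxBound s V} with h𝒱
  have hW : SigmaBoxBound s (⋃₀ 𝒱) := by
    obtain ⟨T, hTc, hTsub, hT⟩ := isOpen_sUnion_countable 𝒱 fun V hV => hV.1
    have := hTc.to_subtype
    rw [← hT, sUnion_eq_iUnion]
    exact .iUnion fun V => (hTsub V.2).2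
  refine ⟨(⋃₀ 𝒱)ᶜ, (isOpen_sUnion fun V hV => hV.1).isClosed_compl, ?_, ?_⟩
  · rw [nonempty_compl]
    exact fun huniv => h (huniv ▸ hW)
  · rintro O hO ⟨x, hxO, hx⟩ hbound
    refine hx (mem_sUnion.2 ⟨O, ⟨hO, (hbound.union hW).mono fun y hy => ?_⟩, hxO⟩)
    by_cases hyW : y ∈ ⋃₀ 𝒱
    · exact Or.inr hyW
    · exact Or.inl ⟨hy, hyW⟩

theorem not_tdim_le_of_ball_subset {F : Set (WithLp 2 (X × UnitCube n))}
    {x : X} {y : UnitCube n} {ε : ℝ} (hε : 0 < ε)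
    (hF : ∀ v : UnitCube n, dist v y < ε → WithLp.toLp 2 (x, v) ∈ F) :
    ¬ tdim F ≤ (n : EReal) - 1 := by
  intro hdim
  obtain ⟨η, hη0, -, j, hj, hjy⟩ := UnitCube.exists_similarity y hε
  have hjc : Continuous j := (LipschitzWith.of_dist_le_mul (K := η.toNNReal) fun u v => by
    rw [Real.coe_toNNReal _ hη0.le, hj]).continuous
  have hji : Function.Injective j := fun u v huv => by
    have := hj u v
    rw [huv, dist_self] at this
    exact dist_eq_zero.1 ((mul_eq_zero.1 this.symm).resolve_left hη0.ne')
  let f : Icc (0 : Fin n → ℝ) 1 → F := fun u =>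
    ⟨WithLp.toLp 2 (x, j (UnitCube.ofCoord u)), hF _ (hjy _)⟩
  have hfc : Continuous f := by
    refine Continuous.subtype_mk ?_ _
    exact (WithLp.prod_continuous_toLp 2 X (UnitCube n)).comp
      (continuous_const.prodMk (hjc.comp UnitCube.continuous_ofCoord))
  have hfi : Function.Injective f := fun u v huv => by
    have h1 := WithLp.toLp_injective 2 (congrArg Subtype.val huv)
    exact UnitCube.injective_ofCoord (hji (Prod.ext_iff.1 h1).2)
  exact not_indBelow_Icc n (indBelow_of_isEmbedding n (hfc.isClosedEmbedding hfi).isEmbedding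
    (indBelow_of_indDim_le hdim))

theorem pdim_add_le_pdim_diff [SeparableSpace X] [CompleteSpace X] [Nonempty X]
    {F : Set (WithLp 2 (X × UnitCube n))} (hF : IsFSigmaIn F univ)
    (hdim : tdim F ≤ (n : EReal) - 1) :
    pdim (univ : Set X) + (n : EReal) ≤ pdim (univ \ F) := by
  have : SecondCountableTopology X := UniformSpace.secondCountable_of_separable X
  obtain ⟨C, hC, hFC⟩ := hF
  by_contra! hlt
  obtain ⟨t, ht1, ht2⟩ := EReal.lt_iff_exists_real_btwn.1 hlt
  obtain ⟨c, hc, hb⟩ := sigmaBoxBound_of_pdim_lt ht1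
  have hX : ¬ SigmaBoxBound (t - n) (univ : Set X) := fun h =>
    (pdim_le_of_sigmaBoxBound h univ_nonempty).not_gt (EReal.coe_sub_natCast_lt ht2)
  obtain ⟨Y, hYc, ⟨x₀, hx₀⟩, hY⟩ := exists_isClosed_not_sigmaBoxBound hX
  have hfst : Continuous fun z : WithLp 2 (X × UnitCube n) => z.fst :=
    continuous_fst.comp (WithLp.prod_continuous_ofLp 2 X (UnitCube n))
  let T : Set (WithLp 2 (X × UnitCube n)) := {z | z.fst ∈ Y}
  have hT : IsClosed T := hYc.preimage hfst
  have : CompleteSpace T := hT.completeSpace_coe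
  have : Nonempty T := ⟨⟨WithLp.toLp 2 (x₀, Classical.arbitrary _), hx₀⟩⟩
  let G : ℕ ⊕ ℕ → Set (WithLp 2 (X × UnitCube n)) := Sum.elim C fun i => closure (c i)
  have hG : ∀ i, IsClosed (G i) := by
    rintro (i | i)
    exacts [hC i, isClosed_closure]
  have hcover : ∀ z, ∃ i, z ∈ G i := by
    intro z
    by_cases hz : z ∈ F
    · rw [hFC] at hz
      obtain ⟨i, hi⟩ := mem_iUnion.1 hz
      exact ⟨.inl i, hi.1⟩
    · obtain ⟨i, hi⟩ := mem_iUnion.1 (hc ⟨mem_univ z, hz⟩)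
      exact ⟨.inr i, subset_closure hi⟩
  obtain ⟨i, z, hz⟩ := nonempty_interior_of_iUnion_of_closed
    (f := fun i => (Subtype.val ⁻¹' G i : Set T)) (fun i => (hG i).preimage continuous_subtype_val)
    (eq_univ_of_forall fun z => mem_iUnion.2 (hcover z))
  obtain ⟨ε, hε, hball⟩ := Metric.isOpen_iff.1 isOpen_interior z hz
  have hmem : ∀ w : WithLp 2 (X × UnitCube n), w.fst ∈ Y → dist w z < ε → w ∈ G i :=
    fun w hw hwz =>
      interior_subset (s := Subtype.val ⁻¹' G i) (hball (show (⟨w, hw⟩ : T) ∈ ball z ε from hwz))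
  rcases i with i | i
  · refine not_tdim_le_of_ball_subset (x := z.1.fst) (y := z.1.snd) hε (fun v hv => ?_) hdim
    rw [hFC]
    refine mem_iUnion.2 ⟨i, hmem _ z.2 (lt_of_le_of_lt
      (WithLp.dist_le_dist_fst_add_dist_snd _ _) ?_), mem_univ _⟩
    simpa using hv
  · refine hY (ball z.1.fst (ε / 2)) isOpen_ball ⟨_, mem_ball_self (half_pos hε), z.2⟩
      (HasBoxBound.sigmaBoxBound ?_)
    have hcl : HasBoxBound (t - n + n) (closure (c i)) := by
      rw [sub_add_cancel]
      exact (hb i).closure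
    refine hcl.of_prod_unitCube (y := z.1.snd) (half_pos hε) fun w hw hwz =>
      hmem w hw.2 (lt_of_le_of_lt (WithLp.dist_le_dist_fst_add_dist_snd _ _) ?_)
    linarith [mem_ball.1 hw.1]

theorem indDim_of_isEmpty [IsEmpty X] : indDim X ≤ (n : EReal) - 1 := by
  refine (sInf_le ⟨0, ‹IsEmpty X›, rfl⟩ : indDim X ≤ ((0 : ℕ) : EReal) - 1).trans ?_
  exact EReal.sub_le_sub (by exact_mod_cast Nat.zero_le n) le_rfl

theorem isFSigmaIn_empty {Z : Type*} [MetricSpace Z] (A : Set Z) : IsFSigmaIn ∅ A :=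
  ⟨fun _ => ∅, fun _ => isClosed_empty, by simp⟩

end Main

/-- `d^n_P(X × [0,1]ⁿ) = dim_P (X × [0,1]ⁿ) = dim_P X + n` for a non-empty Polish space `X`,
with the `ℓ²` product metric. -/
theorem stmt5 (X : Type*) [MetricSpace X] [TopologicalSpace.SeparableSpace X] [CompleteSpace X]
    [Nonempty X] (n : ℕ) (hn : 0 < n) :
    dStar pdim n (Set.univ :
        Set (WithLp 2 (X × {x : EuclideanSpace ℝ (Fin n) // ∀ i, x i ∈ Set.Icc (0:ℝ) 1}))) =
      pdim (Set.univ :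
        Set (WithLp 2 (X × {x : EuclideanSpace ℝ (Fin n) // ∀ i, x i ∈ Set.Icc (0:ℝ) 1}))) ∧
    pdim (Set.univ :
        Set (WithLp 2 (X × {x : EuclideanSpace ℝ (Fin n) // ∀ i, x i ∈ Set.Icc (0:ℝ) 1}))) =
      pdim (Set.univ : Set X) + (n : EReal) := by
  have hle := pdim_prod_unitCube_le (X := X) (n := n)
  have hempty : tdim (∅ : Set (WithLp 2 (X × UnitCube n))) ≤ (n : EReal) - 1 := indDim_of_isEmpty
  have heq := le_antisymm hle (by
    simpa using pdim_add_le_pdim_diff (isFSigmaIn_empty univ) hempty)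
  refine ⟨le_antisymm (sInf_le ⟨∅, isFSigmaIn_empty univ, hempty, by rw [sdiff_empty]⟩) ?_, heq⟩
  refine le_sInf ?_
  rintro _ ⟨F, hF, hdim, rfl⟩
  exact hle.trans (pdim_add_le_pdim_diff hF hdim)
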